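/- arXiv:2001.08039 — 2 statements merged into one kernel-verified Lean document; each statement's English description precedes it below -/
import Mathlib

section
/- For every δ > 0 there exists A > 0 such that for all a > A the third return point of the orbit leaving x = 10/3 satisfies (P_+^a ∘ P_−^a ∘ P_+^a)(10/3) ∈ (20/3, 20/3 + δ); in particular (P_+^a ∘ P_−^a ∘ P_+^a)(10/3) → (20/3)⁺ as a → +∞. -/
open Real Set

/-- The unique solution of `y′(x) = −a·y(x) − sin(ωπx)` with `y(x_i) = 0`
(explicit formula). -/
noncomputable def Ysol (a ω xi x : ℝ) : ℝ :=
  (ω * π * Real.cos (ω * π * x) - a * Real.sin (ω * π * x)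
    + Real.exp (-a * (x - xi)) * (a * Real.sin (ω * π * xi) - ω * π * Real.cos (ω * π * xi)))
    / (ω ^ 2 * π ^ 2 + a ^ 2)

/-- First-return map through the upper half-plane (frequency ω₊ = 3/2):
the next zero after `x_i` of the solution leaving the threshold at `x_i`. -/
noncomputable def Pp (a xi : ℝ) : ℝ := sInf {x : ℝ | xi < x ∧ Ysol a (3 / 2) xi x = 0}

/-- First-return map through the lower half-plane (frequency ω₋ = 1/2). -/
noncomputable def Pm (a xi : ℝ) : ℝ := sInf {x : ℝ | xi < x ∧ Ysol a (1 / 2) xi x = 0}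

/-- The solution vanishes at `x` exactly when this function, up to sign and a shift to a zero of
the forcing term, takes the same value at `x` and at the starting point. -/
noncomputable def weightedForcing (a w t : ℝ) : ℝ :=
  Real.exp (a * t) * (w * Real.cos (w * t) - a * Real.sin (w * t))

lemma hasDerivAt_weightedForcing (a w t : ℝ) :
    HasDerivAt (weightedForcing a w) (-(w ^ 2 + a ^ 2) * Real.exp (a * t) * Real.sin (w * t)) t := by
  have he : HasDerivAt (fun t => Real.exp (a * t)) (Real.exp (a * t) * (a * 1)) t :=
    ((hasDerivAt_id t).const_mul a).exp
  have hw : HasDerivAt (fun t => w * t) (w * 1) t := (hasDerivAt_id t).const_mul w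
  have h := he.mul ((hw.cos.const_mul w).sub (hw.sin.const_mul a))
  refine h.congr_deriv ?_
  simp only [Pi.sub_apply]
  ring

lemma continuous_weightedForcing (a w : ℝ) : Continuous (weightedForcing a w) := by
  unfold weightedForcing
  fun_prop

lemma strictMonoOn_weightedForcing {a w : ℝ} (hw : 0 < w) :
    StrictMonoOn (weightedForcing a w) (Icc (-(π / w)) 0) := by
  refine strictMonoOn_of_deriv_pos (convex_Icc _ _)
    (continuous_weightedForcing a w).continuousOn fun t ht => ?_
  rw [interior_Icc] at ht
  rw [(hasDerivAt_weightedForcing a w t).deriv]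
  have hlow : -π < w * t := by
    have := mul_lt_mul_of_pos_left ht.1 hw
    rwa [mul_neg, mul_div_cancel₀ _ hw.ne'] at this
  have hs := Real.sin_neg_of_neg_of_neg_pi_lt (mul_neg_of_pos_of_neg hw ht.2) hlow
  have : 0 < (w ^ 2 + a ^ 2) * Real.exp (a * t) := by positivity
  nlinarith

lemma strictAntiOn_weightedForcing {a w : ℝ} (hw : 0 < w) :
    StrictAntiOn (weightedForcing a w) (Icc 0 (π / w)) := by
  refine strictAntiOn_of_deriv_neg (convex_Icc _ _)
    (continuous_weightedForcing a w).continuousOn fun t ht => ?_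
  rw [interior_Icc] at ht
  rw [(hasDerivAt_weightedForcing a w t).deriv]
  have hupp : w * t < π := by
    have := mul_lt_mul_of_pos_left ht.2 hw
    rwa [mul_div_cancel₀ _ hw.ne'] at this
  have hs := Real.sin_pos_of_pos_of_lt_pi (mul_pos hw ht.1) hupp
  have : 0 < (w ^ 2 + a ^ 2) * Real.exp (a * t) := by positivity
  nlinarith

lemma exists_isLeast_weightedForcing_eq {a w s η : ℝ} (ha : 0 < a) (hw : 0 < w)
    (hs : -(π / w) ≤ s) (hs0 : s < 0) (hη : 0 < η) (hη' : η ≤ π / w)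
    (hA : 2 * w ≤ a * Real.sin (w * η)) :
    ∃ t ∈ Ioo 0 η,
      IsLeast {t | s < t ∧ weightedForcing a w t = weightedForcing a w s} t := by
  have hmono := strictMonoOn_weightedForcing (a := a) hw
  have hanti := strictAntiOn_weightedForcing (a := a) hw
  have hstart : -w * Real.exp (a * s) ≤ weightedForcing a w s := by
    have hsin : Real.sin (w * s) ≤ 0 := by
      refine Real.sin_nonpos_of_nonpos_of_neg_pi_le (mul_neg_of_pos_of_neg hw hs0).le ?_
      have := mul_le_mul_of_nonneg_left hs hw.le
      rwa [mul_neg, mul_div_cancel₀ _ hw.ne'] at this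
    have hcos := Real.neg_one_le_cos (w * s)
    have : -w ≤ w * Real.cos (w * s) - a * Real.sin (w * s) := by nlinarith
    have := mul_le_mul_of_nonneg_left this (Real.exp_pos (a * s)).le
    unfold weightedForcing
    linarith
  have hend : weightedForcing a w η ≤ -w * Real.exp (a * η) := by
    have hcos := Real.cos_le_one (w * η)
    have : w * Real.cos (w * η) - a * Real.sin (w * η) ≤ -w := by nlinarith
    have := mul_le_mul_of_nonneg_left this (Real.exp_pos (a * η)).le
    unfold weightedForcing
    linarith
  have hexp : Real.exp (a * s) < Real.exp (a * η) :=
    Real.exp_lt_exp.2 (mul_lt_mul_of_pos_left (hs0.trans hη) ha)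
  have hlt : weightedForcing a w η < weightedForcing a w s := by nlinarith
  have hgt : weightedForcing a w s < weightedForcing a w 0 :=
    hmono ⟨hs, hs0.le⟩ ⟨hs.trans hs0.le, le_rfl⟩ hs0
  obtain ⟨t, ht, hts⟩ := intermediate_value_Ioo' hη.le
    (continuous_weightedForcing a w).continuousOn ⟨hlt, hgt⟩
  refine ⟨t, ht, ⟨hs0.trans ht.1, hts⟩, fun u hu => ?_⟩
  by_contra! hut
  rcases le_or_gt u 0 with hu0 | hu0
  · exact (hmono ⟨hs, hs0.le⟩ ⟨hs.trans hu.1.le, hu0⟩ hu.1).ne' hu.2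
  · have htη : t ≤ π / w := ht.2.le.trans hη'
    exact (hanti ⟨hu0.le, hut.le.trans htη⟩ ⟨ht.1.le, htη⟩ hut).ne (hts.trans hu.2.symm)

lemma Ysol_eq_zero_iff {a ω c : ℝ} (ha : 0 < a) (hc : Real.sin (ω * π * c) = 0) (xi x : ℝ) :
    Ysol a ω xi x = 0 ↔
      weightedForcing a (ω * π) (x - c) = weightedForcing a (ω * π) (xi - c) := by
  have hε : Real.cos (ω * π * c) ≠ 0 := by
    intro h
    have := Real.sin_sq_add_cos_sq (ω * π * c)
    simp [h, hc] at this
  have hcos (y : ℝ) :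
      Real.cos (ω * π * y) = Real.cos (ω * π * c) * Real.cos (ω * π * (y - c)) := by
    rw [show ω * π * y = ω * π * c + ω * π * (y - c) by ring, Real.cos_add, hc]
    ring_nf
  have hsin (y : ℝ) :
      Real.sin (ω * π * y) = Real.cos (ω * π * c) * Real.sin (ω * π * (y - c)) := by
    rw [show ω * π * y = ω * π * c + ω * π * (y - c) by ring, Real.sin_add, hc]
    ring_nf
  have hexp : Real.exp (-a * (x - xi)) * Real.exp (a * (x - c)) = Real.exp (a * (xi - c)) := by
    rw [← Real.exp_add]
    ring_nf
  have hne : ω ^ 2 * π ^ 2 + a ^ 2 ≠ 0 := by positivity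
  have key : (ω * π * Real.cos (ω * π * x) - a * Real.sin (ω * π * x)
      + Real.exp (-a * (x - xi)) * (a * Real.sin (ω * π * xi) - ω * π * Real.cos (ω * π * xi)))
      * Real.exp (a * (x - c)) = Real.cos (ω * π * c) *
        (weightedForcing a (ω * π) (x - c) - weightedForcing a (ω * π) (xi - c)) := by
    unfold weightedForcing
    rw [hcos x, hsin x, hcos xi, hsin xi, ← hexp]
    ring
  rw [Ysol, div_eq_zero_iff, or_iff_left hne, ← sub_eq_zero (a := weightedForcing _ _ _),
    ← mul_eq_zero_iff_right (Real.exp_pos (a * (x - c))).ne', key, mul_eq_zero, or_iff_right hε]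

/-- A solution started in the half-period before a zero `c` of the forcing term first returns to
zero just after `c`, if `a` is large. -/
lemma isLeast_return {a ω c xi η : ℝ} (ha : 0 < a) (hω : 0 < ω)
    (hc : Real.sin (ω * π * c) = 0) (hxi : c - 1 / ω ≤ xi) (hxic : xi < c)
    (hη : 0 < η) (hη' : η ≤ 1 / ω) (hA : 2 * (ω * π) ≤ a * Real.sin (ω * π * η)) :
    IsLeast {x | xi < x ∧ Ysol a ω xi x = 0} (sInf {x | xi < x ∧ Ysol a ω xi x = 0}) ∧
      sInf {x | xi < x ∧ Ysol a ω xi x = 0} ∈ Ioo c (c + η) := by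
  have hp : π / (ω * π) = 1 / ω := by field_simp
  obtain ⟨t, ht, ⟨hst, hts⟩, hleast⟩ := exists_isLeast_weightedForcing_eq (s := xi - c) ha
    (mul_pos hω Real.pi_pos) (by rw [hp]; linarith) (by linarith) hη (by rwa [hp]) hA
  have h : IsLeast {x | xi < x ∧ Ysol a ω xi x = 0} (c + t) := by
    refine ⟨⟨by linarith, (Ysol_eq_zero_iff ha hc _ _).2 ?_⟩, fun x hx => ?_⟩
    · rwa [add_sub_cancel_left]
    · have := hleast ⟨sub_lt_sub_right hx.1 c, (Ysol_eq_zero_iff ha hc _ _).1 hx.2⟩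
      linarith
  rw [h.csInf_eq]
  exact ⟨h, by linarith [ht.1], by linarith [ht.2]⟩

/-- the third return point of the orbit leaving `x = 10/3`
tends to `(20/3)⁺` as `a → +∞`: for every `δ > 0` there is `A > 0` such
that for all `a > A` the three successive return points are well defined
(as minima) and `(P₊ᵃ ∘ P₋ᵃ ∘ P₊ᵃ)(10/3) ∈ (20/3, 20/3 + δ)`. -/
theorem third_return_from_ten_thirds :
    ∀ δ : ℝ, 0 < δ → ∃ A : ℝ, 0 < A ∧ ∀ a : ℝ, A < a →
      IsLeast {x : ℝ | 10 / 3 < x ∧ Ysol a (3 / 2) (10 / 3) x = 0} (Pp a (10 / 3)) ∧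
      IsLeast {x : ℝ | Pp a (10 / 3) < x ∧ Ysol a (1 / 2) (Pp a (10 / 3)) x = 0}
        (Pm a (Pp a (10 / 3))) ∧
      IsLeast {x : ℝ | Pm a (Pp a (10 / 3)) < x ∧
          Ysol a (3 / 2) (Pm a (Pp a (10 / 3))) x = 0}
        (Pp a (Pm a (Pp a (10 / 3)))) ∧
      Pp a (Pm a (Pp a (10 / 3))) ∈ Set.Ioo (20 / 3 : ℝ) (20 / 3 + δ) := by
  intro δ hδ
  have hη : 0 < min δ (1 / 3) := by positivity
  have hηδ : min δ (1 / 3) ≤ δ := min_le_left _ _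
  have hη3 : min δ (1 / 3) ≤ 1 / 3 := min_le_right _ _
  set η := min δ (1 / 3)
  have hπ := Real.pi_pos
  have hplus : 0 < Real.sin (3 / 2 * π * η) :=
    Real.sin_pos_of_pos_of_lt_pi (by positivity) (by nlinarith)
  have hminus : 0 < Real.sin (1 / 2 * π * η) :=
    Real.sin_pos_of_pos_of_lt_pi (by positivity) (by nlinarith)
  refine ⟨max (2 * (3 / 2 * π) / Real.sin (3 / 2 * π * η))
    (2 * (1 / 2 * π) / Real.sin (1 / 2 * π * η)), by positivity, fun a hA => ?_⟩
  obtain ⟨hA1, hA2⟩ := max_lt_iff.1 hA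
  have ha : 0 < a := lt_trans (by positivity) hA1
  rw [div_lt_iff₀ hplus] at hA1
  rw [div_lt_iff₀ hminus] at hA2
  obtain ⟨h1, h1l, h1u⟩ := isLeast_return (ω := 3 / 2) (c := 4) (xi := 10 / 3) ha (by norm_num)
    (by rw [show 3 / 2 * π * 4 = (6 : ℕ) * π by push_cast; ring]; exact Real.sin_nat_mul_pi 6)
    (by norm_num) (by norm_num) hη (by linarith) hA1.le
  change IsLeast _ (Pp a (10 / 3)) at h1
  change 4 < Pp a (10 / 3) at h1l
  change Pp a (10 / 3) < 4 + η at h1u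
  obtain ⟨h2, h2l, h2u⟩ := isLeast_return (ω := 1 / 2) (c := 6) (xi := Pp a (10 / 3)) ha
    (by norm_num)
    (by rw [show 1 / 2 * π * 6 = (3 : ℕ) * π by push_cast; ring]; exact Real.sin_nat_mul_pi 3)
    (by norm_num; linarith) (by linarith) hη (by linarith) hA2.le
  change IsLeast _ (Pm a (Pp a (10 / 3))) at h2
  change 6 < Pm a (Pp a (10 / 3)) at h2l
  change Pm a (Pp a (10 / 3)) < 6 + η at h2u
  obtain ⟨h3, h3l, h3u⟩ := isLeast_return (ω := 3 / 2) (c := 20 / 3)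
    (xi := Pm a (Pp a (10 / 3))) ha (by norm_num)
    (by rw [show 3 / 2 * π * (20 / 3) = (10 : ℕ) * π by push_cast; ring]
        exact Real.sin_nat_mul_pi 10)
    (by norm_num; linarith) (by linarith) hη (by linarith) hA1.le
  exact ⟨h1, h2, h3, h3l, h3u.trans_le (by linarith)⟩
end

section
/- There exists a_h > 0 such that for every a > a_h the following hold. Set x₁ := P_+^a(10/3), x₂ := P_−^a(x₁), x₃ := P_+^a(x₂); then x₁ ∈ (4, 14/3), x₂ ∈ (6, 20/3) and x₃ ∈ (20/3, 22/3). The function y defined on [10/3, 22/3] by y = Y_{a,3/2,10/3} on [10/3, x₁], y = Y_{a,1/2,x₁} on [x₁, x₂], y = Y_{a,3/2,x₂} on [x₂, x₃], and y = 0 on [x₃, 22/3] is continuous, satisfies y > 0 on (10/3, x₁) ∪ (x₂, x₃) and y < 0 on (x₁, x₂), extends to a continuous 4-periodic function on ℝ, and on the sliding segment every x ∈ (20/3, 22/3) admits λ ∈ (−1, 1) with [1 + (1+λ)cos(πx)]·sin(πx/2) = 0 (the Filippov sliding condition of the linear switching system). Moreover there exists ν(a) > 0 such that for every x_i ∈ (10/3,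 10/3 + ν(a)) one has (P_+^a ∘ P_−^a ∘ P_+^a)(x_i) ∈ (20/3, 22/3), so orbits starting in (8/3, 10/3) ∪ (10/3, 10/3 + ν(a)) reach the sliding 4-periodic solution in finite time. -/
open Real Set

open AddCircle in
/-- A continuous function on `ℝ` taking equal values at the ends of a period interval agrees there
with a continuous periodic function. -/
theorem exists_continuous_periodic_eqOn_Icc {f : ℝ → ℝ} (hf : Continuous f) {s p : ℝ} (hp : 0 < p)
    (hends : f s = f (s + p)) :
    ∃ y : ℝ → ℝ, Continuous y ∧ (∀ x, y (x + p) = y x) ∧ ∀ x ∈ Icc s (s + p), y x = f x := by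
  have : Fact (0 < p) := ⟨hp⟩
  have hper : ∀ x : ℝ, liftIco p s f ((x + p : ℝ) : AddCircle p) = liftIco p s f (x : AddCircle p) :=
    fun x => by rw [AddCircle.coe_add_period]
  refine ⟨fun x => liftIco p s f (x : AddCircle p),
    (liftIco_continuous hends hf.continuousOn).comp (AddCircle.continuous_mk' p), hper, ?_⟩
  rintro x ⟨hsx, hxs⟩
  rcases hxs.lt_or_eq with h | rfl
  · exact liftIco_coe_apply ⟨hsx, h⟩
  · simp only [hper]
    rw [liftIco_coe_apply ⟨le_rfl, by linarith⟩, hends]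

/-- A continuous function increasing on `[s, m]` and decreasing on `[m, b]`, with a lower value at
`b` than at `s`, returns to its initial value at a first point, lying in `(m, b)`. -/
theorem exists_first_return {f : ℝ → ℝ} {s m b : ℝ} (hf : Continuous f) (hsm : s < m) (hmb : m < b)
    (hmono : StrictMonoOn f (Icc s m)) (hanti : StrictAntiOn f (Icc m b)) (hb : f b < f s) :
    ∃ c ∈ Ioo m b, f c = f s ∧ ∀ x ∈ Ioo s c, f s < f x := by
  have hm : f s < f m := hmono ⟨le_rfl, hsm.le⟩ ⟨hsm.le, le_rfl⟩ hsm
  obtain ⟨c, hc, hcs⟩ := intermediate_value_Ioo' hmb.le hf.continuousOn ⟨hb, hm⟩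
  refine ⟨c, hc, hcs, fun x hx => ?_⟩
  rcases le_total x m with h | h
  · exact hmono ⟨le_rfl, hsm.le⟩ ⟨hx.1.le, h⟩ hx.1
  · exact hcs ▸ hanti ⟨h, (hx.2.trans hc.2).le⟩ ⟨hc.1.le, hc.2.le⟩ hx.2

theorem continuous_Ysol (a ω xi : ℝ) : Continuous (Ysol a ω xi) := by
  unfold Ysol
  fun_prop

theorem Ysol_self (a ω xi : ℝ) : Ysol a ω xi xi = 0 := by
  simp [Ysol]

/-- `e^{ax}(w cos(wx) - a sin(wx))`, whose increment from `xi` to `x` has the sign of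
`Ysol a ω xi x` when `w = ωπ`. -/
noncomputable def scaledForcing (a w x : ℝ) : ℝ :=
  Real.exp (a * x) * (w * Real.cos (w * x) - a * Real.sin (w * x))

theorem continuous_scaledForcing (a w : ℝ) : Continuous (scaledForcing a w) := by
  unfold scaledForcing
  fun_prop

theorem hasDerivAt_scaledForcing (a w x : ℝ) :
    HasDerivAt (scaledForcing a w) (-((a ^ 2 + w ^ 2) * Real.exp (a * x) * Real.sin (w * x))) x := by
  have hw : HasDerivAt (fun x : ℝ => w * x) w x := by simpa using (hasDerivAt_id x).const_mul w
  have ha : HasDerivAt (fun x : ℝ => a * x) a x := by simpa using (hasDerivAt_id x).const_mul a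
  exact (ha.exp.mul ((hw.cos.const_mul w).sub (hw.sin.const_mul a))).congr_deriv (by
    simp only [Pi.sub_apply]; ring)

theorem strictMonoOn_scaledForcing {a w s t : ℝ} (ha : 0 < a)
    (h : ∀ x ∈ Ioo s t, Real.sin (w * x) < 0) : StrictMonoOn (scaledForcing a w) (Icc s t) := by
  refine strictMonoOn_of_deriv_pos (convex_Icc _ _) (continuous_scaledForcing a w).continuousOn ?_
  intro x hx
  rw [interior_Icc] at hx
  rw [(hasDerivAt_scaledForcing a w x).deriv, ← mul_neg]
  exact mul_pos (by positivity) (neg_pos.2 (h x hx))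

theorem strictAntiOn_scaledForcing {a w s t : ℝ} (ha : 0 < a)
    (h : ∀ x ∈ Ioo s t, 0 < Real.sin (w * x)) : StrictAntiOn (scaledForcing a w) (Icc s t) := by
  refine strictAntiOn_of_deriv_neg (convex_Icc _ _) (continuous_scaledForcing a w).continuousOn ?_
  intro x hx
  rw [interior_Icc] at hx
  rw [(hasDerivAt_scaledForcing a w x).deriv]
  exact neg_neg_of_pos (mul_pos (by positivity) (h x hx))

theorem Ysol_eq_scaledForcing_sub (a ω xi x : ℝ) :
    Ysol a ω xi x = Real.exp (-(a * x)) / (ω ^ 2 * π ^ 2 + a ^ 2) *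
      (scaledForcing a (ω * π) x - scaledForcing a (ω * π) xi) := by
  have h1 : Real.exp (-a * (x - xi)) = Real.exp (-(a * x)) * Real.exp (a * xi) := by
    rw [← Real.exp_add]; ring_nf
  have h2 : Real.exp (-(a * x)) * Real.exp (a * x) = 1 := by
    rw [← Real.exp_add]; simp
  unfold Ysol scaledForcing
  rw [h1, div_mul_eq_mul_div]
  congr 1
  linear_combination
    -(ω * π * Real.cos (ω * π * x) - a * Real.sin (ω * π * x)) * h2

section signs

variable {a ω xi x : ℝ}

theorem Ysol_pos_iff (ha : 0 < a) :
    0 < Ysol a ω xi x ↔ scaledForcing a (ω * π) xi < scaledForcing a (ω * π) x := by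
  rw [Ysol_eq_scaledForcing_sub, mul_pos_iff_of_pos_left (by positivity), sub_pos]

theorem Ysol_neg_iff (ha : 0 < a) :
    Ysol a ω xi x < 0 ↔ scaledForcing a (ω * π) x < scaledForcing a (ω * π) xi := by
  rw [Ysol_eq_scaledForcing_sub, ← neg_pos, ← mul_neg, mul_pos_iff_of_pos_left (by positivity),
    neg_pos, sub_neg]

theorem Ysol_eq_zero (h : scaledForcing a (ω * π) x = scaledForcing a (ω * π) xi) :
    Ysol a ω xi x = 0 := by
  rw [Ysol_eq_scaledForcing_sub, h, sub_self, mul_zero]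

end signs

/-- The upper first-return map sends `[4k/3 - 2/3, 4k/3)` into `(4k/3, 4k/3 + 2/3)`. -/
theorem Pp_spec {a xi : ℝ} (ha : 0 < a) (k : ℕ) (hxi : xi ∈ Ico (4 * k / 3 - 2 / 3 : ℝ) (4 * k / 3)) :
    IsLeast {x : ℝ | xi < x ∧ Ysol a (3 / 2) xi x = 0} (Pp a xi) ∧
      Pp a xi ∈ Ioo (4 * k / 3 : ℝ) (4 * k / 3 + 2 / 3) ∧
      ∀ x ∈ Ioo xi (Pp a xi), 0 < Ysol a (3 / 2) xi x := by
  have hπ := Real.pi_pos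
  have hshift : ∀ x : ℝ, 3 / 2 * π * x = 3 / 2 * π * (x - 4 * k / 3) + k * (2 * π) := fun x => by ring
  have hneg : ∀ x ∈ Ioo xi (4 * k / 3 : ℝ), Real.sin (3 / 2 * π * x) < 0 := fun x hx => by
    rw [hshift, Real.sin_add_nat_mul_two_pi]
    apply Real.sin_neg_of_neg_of_neg_pi_lt <;> nlinarith [hx.1, hx.2, hxi.1]
  have hpos : ∀ x ∈ Ioo (4 * k / 3 : ℝ) (4 * k / 3 + 2 / 3), 0 < Real.sin (3 / 2 * π * x) :=
    fun x hx => by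
      rw [hshift, Real.sin_add_nat_mul_two_pi]
      apply Real.sin_pos_of_pos_of_lt_pi <;> nlinarith [hx.1, hx.2]
  have hend : scaledForcing a (3 / 2 * π) (4 * k / 3 + 2 / 3) < scaledForcing a (3 / 2 * π) xi := by
    have hs : Real.sin (3 / 2 * π * xi) ≤ 0 := by
      rw [hshift, Real.sin_add_nat_mul_two_pi]
      apply Real.sin_nonpos_of_nonpos_of_neg_pi_le <;> nlinarith [hxi.1, hxi.2]
    have he : Real.exp (a * xi) < Real.exp (a * (4 * k / 3 + 2 / 3)) :=
      Real.exp_lt_exp.2 (by nlinarith [hxi.2])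
    have hangle : 3 / 2 * π * (4 * k / 3 + 2 / 3) = π + k * (2 * π) := by ring
    unfold scaledForcing
    rw [hangle, Real.sin_add_nat_mul_two_pi, Real.cos_add_nat_mul_two_pi, Real.sin_pi, Real.cos_pi]
    calc Real.exp (a * (4 * k / 3 + 2 / 3)) * (3 / 2 * π * -1 - a * 0)
        < Real.exp (a * xi) * (-(3 / 2 * π)) := by nlinarith
      _ ≤ _ := by
        gcongr
        nlinarith [Real.neg_one_le_cos (3 / 2 * π * xi), mul_nonneg ha.le (neg_nonneg.2 hs)]
  obtain ⟨c, hc, hcs, hpc⟩ := exists_first_return (continuous_scaledForcing a (3 / 2 * π)) hxi.2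
    (by linarith) (strictMonoOn_scaledForcing ha hneg) (strictAntiOn_scaledForcing ha hpos) hend
  have hleast : IsLeast {x : ℝ | xi < x ∧ Ysol a (3 / 2) xi x = 0} c := by
    refine ⟨⟨hxi.2.trans hc.1, Ysol_eq_zero hcs⟩, fun x hx => ?_⟩
    by_contra! hlt
    exact ((Ysol_pos_iff ha).2 (hpc x ⟨hx.1, hlt⟩)).ne' hx.2
  have hP : Pp a xi = c := hleast.csInf_eq
  rw [hP]
  exact ⟨hleast, hc, fun x hx => (Ysol_pos_iff ha).2 (hpc x hx)⟩

/-- For `a > 4` the lower first-return map sends `(4, 14/3)` into `(6, 20/3)`. -/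
theorem Pm_spec {a xi : ℝ} (ha : 4 < a) (hxi : xi ∈ Ioo (4 : ℝ) (14 / 3)) :
    IsLeast {x : ℝ | xi < x ∧ Ysol a (1 / 2) xi x = 0} (Pm a xi) ∧
      Pm a xi ∈ Ioo (6 : ℝ) (20 / 3) ∧
      ∀ x ∈ Ioo xi (Pm a xi), Ysol a (1 / 2) xi x < 0 := by
  have hπ := Real.pi_pos
  have ha0 : 0 < a := by linarith
  have hshift : ∀ x : ℝ, 1 / 2 * π * x = 1 / 2 * π * (x - 6) + π + 2 * π := fun x => by ring
  have hsin : ∀ x : ℝ, Real.sin (1 / 2 * π * x) = -Real.sin (1 / 2 * π * (x - 6)) := fun x => by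
    rw [hshift, Real.sin_add_two_pi, Real.sin_add_pi]
  have hcos : ∀ x : ℝ, Real.cos (1 / 2 * π * x) = -Real.cos (1 / 2 * π * (x - 6)) := fun x => by
    rw [hshift, Real.cos_add_two_pi, Real.cos_add_pi]
  have hpos : ∀ x ∈ Ioo xi (6 : ℝ), 0 < Real.sin (1 / 2 * π * x) := fun x hx => by
    rw [hsin, neg_pos]
    apply Real.sin_neg_of_neg_of_neg_pi_lt <;> nlinarith [hx.1, hx.2, hxi.1]
  have hneg : ∀ x ∈ Ioo (6 : ℝ) (20 / 3), Real.sin (1 / 2 * π * x) < 0 := fun x hx => by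
    rw [hsin, neg_lt_zero]
    apply Real.sin_pos_of_pos_of_lt_pi <;> nlinarith [hx.1, hx.2]
  have hend : scaledForcing a (1 / 2 * π) xi < scaledForcing a (1 / 2 * π) (20 / 3) := by
    have hs : 0 ≤ Real.sin (1 / 2 * π * xi) := by
      rw [hsin, neg_nonneg]
      apply Real.sin_nonpos_of_nonpos_of_neg_pi_le <;> nlinarith [hxi.1, hxi.2]
    have he : Real.exp (a * xi) < Real.exp (a * (20 / 3)) :=
      Real.exp_lt_exp.2 (by nlinarith [hxi.2])
    have hangle : 1 / 2 * π * (20 / 3 - 6) = π / 3 := by ring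
    have h3 : (17 / 10 : ℝ) < √3 := Real.lt_sqrt_of_sq_lt (by norm_num)
    have hp4 := Real.pi_lt_d2
    unfold scaledForcing
    rw [hsin (20 / 3), hcos (20 / 3), hangle, Real.sin_pi_div_three, Real.cos_pi_div_three]
    calc _ ≤ Real.exp (a * xi) * (1 / 2 * π) := by
          gcongr
          nlinarith [Real.cos_le_one (1 / 2 * π * xi), mul_nonneg ha0.le hs]
      _ < Real.exp (a * (20 / 3)) * (1 / 2 * π) := by gcongr
      _ ≤ _ := by
          gcongr
          nlinarith
  obtain ⟨c, hc, hcs, hpc⟩ := exists_first_return (f := fun x => -scaledForcing a (1 / 2 * π) x)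
    (continuous_scaledForcing a (1 / 2 * π)).neg (by linarith [hxi.2]) (by norm_num)
    (strictAntiOn_scaledForcing ha0 hpos).neg (strictMonoOn_scaledForcing ha0 hneg).neg
    (neg_lt_neg hend)
  have hlt : ∀ x ∈ Ioo xi c, Ysol a (1 / 2) xi x < 0 :=
    fun x hx => (Ysol_neg_iff ha0).2 (neg_lt_neg_iff.1 (hpc x hx))
  have hleast : IsLeast {x : ℝ | xi < x ∧ Ysol a (1 / 2) xi x = 0} c := by
    refine ⟨⟨by linarith [hxi.2, hc.1], Ysol_eq_zero (neg_injective hcs)⟩, fun x hx => ?_⟩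
    by_contra! h
    exact (hlt x ⟨hx.1, h⟩).ne hx.2
  have hP : Pm a xi = c := hleast.csInf_eq
  rw [hP]
  exact ⟨hleast, hc, hlt⟩

/-- The Filippov sliding condition holds on `(20/3, 22/3)`. -/
theorem exists_filippov_sliding {x : ℝ} (hx : x ∈ Ioo (20 / 3 : ℝ) (22 / 3)) :
    ∃ lam ∈ Ioo (-1 : ℝ) 1, (1 + (1 + lam) * Real.cos (π * x)) * Real.sin (π * x / 2) = 0 := by
  have hπ := Real.pi_pos
  have hcos : Real.cos (π * x) = -Real.cos |π * (x - 7)| := by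
    have hshift : π * x = π * (x - 7) + π + (3 : ℕ) * (2 * π) := by push_cast; ring
    rw [hshift, Real.cos_add_nat_mul_two_pi, Real.cos_add_pi, Real.cos_abs]
  have habs : |π * (x - 7)| < π / 3 := by
    rw [abs_lt]
    constructor <;> nlinarith [hx.1, hx.2]
  have hhalf : 1 / 2 < Real.cos |π * (x - 7)| := by
    rw [← Real.cos_pi_div_three]
    exact Real.cos_lt_cos_of_nonneg_of_le_pi (abs_nonneg _) (by linarith) habs
  have hc : 0 < Real.cos |π * (x - 7)| := by linarith
  refine ⟨1 / Real.cos |π * (x - 7)| - 1, ⟨?_, ?_⟩, ?_⟩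
  · have : 0 < 1 / Real.cos |π * (x - 7)| := by positivity
    linarith
  · have : 1 / Real.cos |π * (x - 7)| < 2 := by
      rw [div_lt_iff₀ hc]; linarith
    linarith
  · rw [hcos]
    field_simp
    ring

/-- The arc of `Ysol a ω l` over `[l, r]`, continued by constants outside. -/
noncomputable def clampedArc (a ω l r x : ℝ) : ℝ := Ysol a ω l (max l (min x r))

section clampedArc

variable {a ω l r x : ℝ}

theorem continuous_clampedArc : Continuous (clampedArc a ω l r) :=
  (continuous_Ysol a ω l).comp (by fun_prop)

theorem clampedArc_of_mem (hx : x ∈ Icc l r) : clampedArc a ω l r x = Ysol a ω l x := by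
  rw [clampedArc, min_eq_left hx.2, max_eq_right hx.1]

theorem clampedArc_of_le (hx : x ≤ l) : clampedArc a ω l r x = 0 := by
  rw [clampedArc, max_eq_left ((min_le_left x r).trans hx), Ysol_self]

theorem clampedArc_of_ge (hlr : l ≤ r) (hr : Ysol a ω l r = 0) (hx : r ≤ x) :
    clampedArc a ω l r x = 0 := by
  rw [clampedArc, min_eq_right hx, max_eq_right hlr, hr]

end clampedArc

/-- for all sufficiently large `a` the linear switching system
has a sliding 4-periodic solution built from the orbit leaving `x = 10/3`,
and nearby orbits reach it in finite time. -/
theorem sliding_periodic_orbit_large_damping :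
    ∃ ah : ℝ, 0 < ah ∧ ∀ a : ℝ, ah < a →
      IsLeast {x : ℝ | 10 / 3 < x ∧ Ysol a (3 / 2) (10 / 3) x = 0} (Pp a (10 / 3)) ∧
      IsLeast {x : ℝ | Pp a (10 / 3) < x ∧ Ysol a (1 / 2) (Pp a (10 / 3)) x = 0}
        (Pm a (Pp a (10 / 3))) ∧
      IsLeast {x : ℝ | Pm a (Pp a (10 / 3)) < x ∧
          Ysol a (3 / 2) (Pm a (Pp a (10 / 3))) x = 0}
        (Pp a (Pm a (Pp a (10 / 3)))) ∧
      Pp a (10 / 3) ∈ Set.Ioo (4 : ℝ) (14 / 3) ∧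
      Pm a (Pp a (10 / 3)) ∈ Set.Ioo (6 : ℝ) (20 / 3) ∧
      Pp a (Pm a (Pp a (10 / 3))) ∈ Set.Ioo (20 / 3 : ℝ) (22 / 3) ∧
      (∃ y : ℝ → ℝ, Continuous y ∧ (∀ x : ℝ, y (x + 4) = y x) ∧
        (∀ x ∈ Set.Icc (10 / 3 : ℝ) (Pp a (10 / 3)), y x = Ysol a (3 / 2) (10 / 3) x) ∧
        (∀ x ∈ Set.Icc (Pp a (10 / 3)) (Pm a (Pp a (10 / 3))),
          y x = Ysol a (1 / 2) (Pp a (10 / 3)) x) ∧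
        (∀ x ∈ Set.Icc (Pm a (Pp a (10 / 3))) (Pp a (Pm a (Pp a (10 / 3)))),
          y x = Ysol a (3 / 2) (Pm a (Pp a (10 / 3))) x) ∧
        (∀ x ∈ Set.Icc (Pp a (Pm a (Pp a (10 / 3)))) (22 / 3 : ℝ), y x = 0) ∧
        (∀ x ∈ Set.Ioo (10 / 3 : ℝ) (Pp a (10 / 3)), 0 < y x) ∧
        (∀ x ∈ Set.Ioo (Pm a (Pp a (10 / 3))) (Pp a (Pm a (Pp a (10 / 3)))), 0 < y x) ∧
        (∀ x ∈ Set.Ioo (Pp a (10 / 3)) (Pm a (Pp a (10 / 3))), y x < 0) ∧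
        (∀ x ∈ Set.Ioo (20 / 3 : ℝ) (22 / 3), ∃ lam ∈ Set.Ioo (-1 : ℝ) 1,
          (1 + (1 + lam) * Real.cos (π * x)) * Real.sin (π * x / 2) = 0)) ∧
      ∃ ν : ℝ, 0 < ν ∧ ∀ xi ∈ Set.Ioo (10 / 3 : ℝ) (10 / 3 + ν),
        Pp a (Pm a (Pp a xi)) ∈ Set.Ioo (20 / 3 : ℝ) (22 / 3) := by
  have upper₁ : ∀ {a xi : ℝ}, 4 < a → xi ∈ Ico (10 / 3 : ℝ) 4 →
      IsLeast {x : ℝ | xi < x ∧ Ysol a (3 / 2) xi x = 0} (Pp a xi) ∧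
        Pp a xi ∈ Ioo (4 : ℝ) (14 / 3) ∧ ∀ x ∈ Ioo xi (Pp a xi), 0 < Ysol a (3 / 2) xi x := by
    intro a xi ha hxi
    have h := Pp_spec (a := a) (xi := xi) (by linarith) 3 (by norm_num; exact hxi)
    norm_num at h ⊢
    exact h
  have upper₂ : ∀ {a xi : ℝ}, 4 < a → xi ∈ Ioo (6 : ℝ) (20 / 3) →
      IsLeast {x : ℝ | xi < x ∧ Ysol a (3 / 2) xi x = 0} (Pp a xi) ∧
        Pp a xi ∈ Ioo (20 / 3 : ℝ) (22 / 3) ∧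
        ∀ x ∈ Ioo xi (Pp a xi), 0 < Ysol a (3 / 2) xi x := by
    intro a xi ha hxi
    have h := Pp_spec (a := a) (xi := xi) (by linarith) 5 (by norm_num; exact ⟨hxi.1.le, hxi.2⟩)
    norm_num at h ⊢
    exact h
  refine ⟨4, by norm_num, fun a ha => ?_⟩
  obtain ⟨least₁, mem₁, pos₁⟩ := upper₁ ha (show (10 / 3 : ℝ) ∈ Ico (10 / 3 : ℝ) 4 by norm_num)
  obtain ⟨least₂, mem₂, neg₂⟩ := Pm_spec ha mem₁
  obtain ⟨least₃, mem₃, pos₃⟩ := upper₂ ha mem₂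
  refine ⟨least₁, least₂, least₃, mem₁, mem₂, mem₃, ?_, 2 / 3, by norm_num, fun xi hxi =>
    (upper₂ ha (Pm_spec ha (upper₁ ha ⟨hxi.1.le, by linarith [hxi.2]⟩).2.1).2.1).2.1⟩
  generalize Pp a (Pm a (Pp a (10 / 3))) = x₃ at *
  generalize Pm a (Pp a (10 / 3)) = x₂ at *
  generalize Pp a (10 / 3) = x₁ at *
  have h01 := least₁.1.1
  have h12 := least₂.1.1
  have h23 := least₃.1.1
  have after₁ : ∀ {x}, x₁ ≤ x → clampedArc a (3 / 2) (10 / 3) x₁ x = 0 :=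
    clampedArc_of_ge h01.le least₁.1.2
  have after₂ : ∀ {x}, x₂ ≤ x → clampedArc a (1 / 2) x₁ x₂ x = 0 :=
    clampedArc_of_ge h12.le least₂.1.2
  have after₃ : ∀ {x}, x₃ ≤ x → clampedArc a (3 / 2) x₂ x₃ x = 0 :=
    clampedArc_of_ge h23.le least₃.1.2
  obtain ⟨y, hcont, hper, hy⟩ := exists_continuous_periodic_eqOn_Icc
    (f := fun x => clampedArc a (3 / 2) (10 / 3) x₁ x + clampedArc a (1 / 2) x₁ x₂ x +
      clampedArc a (3 / 2) x₂ x₃ x) (s := 10 / 3) (p := 4)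
    ((continuous_clampedArc.add continuous_clampedArc).add continuous_clampedArc) (by norm_num) (by
      have := mem₃.2
      rw [clampedArc_of_le le_rfl, clampedArc_of_le h01.le, clampedArc_of_le (h01.trans h12).le,
        after₁ (by linarith), after₂ (by linarith), after₃ (by linarith)])
  have := mem₃.2
  have arc₁ : ∀ x ∈ Icc (10 / 3 : ℝ) x₁, y x = Ysol a (3 / 2) (10 / 3) x := fun x hx => by
    rw [hy x ⟨hx.1, by linarith [hx.2]⟩, clampedArc_of_mem hx, clampedArc_of_le hx.2,
      clampedArc_of_le (hx.2.trans h12.le), add_zero, add_zero]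
  have arc₂ : ∀ x ∈ Icc x₁ x₂, y x = Ysol a (1 / 2) x₁ x := fun x hx => by
    rw [hy x ⟨by linarith [hx.1], by linarith [hx.2]⟩, after₁ hx.1, clampedArc_of_mem hx,
      clampedArc_of_le hx.2, add_zero, zero_add]
  have arc₃ : ∀ x ∈ Icc x₂ x₃, y x = Ysol a (3 / 2) x₂ x := fun x hx => by
    rw [hy x ⟨by linarith [hx.1], by linarith [hx.2]⟩, after₁ (h12.le.trans hx.1), after₂ hx.1,
      clampedArc_of_mem hx, add_zero, zero_add]
  have rest : ∀ x ∈ Icc x₃ (22 / 3 : ℝ), y x = 0 := fun x hx => by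
    rw [hy x ⟨by linarith [hx.1], by linarith [hx.2]⟩, after₁ (by linarith [hx.1]),
      after₂ (by linarith [hx.1]), after₃ hx.1, add_zero, add_zero]
  exact ⟨y, hcont, hper, arc₁, arc₂, arc₃, rest,
    fun x hx => (arc₁ x (Ioo_subset_Icc_self hx)).symm ▸ pos₁ x hx,
    fun x hx => (arc₃ x (Ioo_subset_Icc_self hx)).symm ▸ pos₃ x hx,
    fun x hx => (arc₂ x (Ioo_subset_Icc_self hx)).symm ▸ neg₂ x hx,
    fun x hx => exists_filippov_sliding hx⟩
end
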